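/- arXiv:1311.5878 — 2 statements merged into one kernel-verified Lean document; each statement's English description precedes it below -/
import Mathlib

section
/- Let (X, Y, π) be an irreducible factor triple and let y be a right transitive point of Y. Then there is no transition between any two distinct transition classes over y: if [x] ≠ [x̄] are classes over y, then x → x̄ fails. -/
open Set

universe u v uc

variable {A : Type u} {B : Type v}

/-- The shift by `n` on points of the full shift `ℤ → A`. -/
def shiftMap (n : ℤ) (x : ℤ → A) : ℤ → A := fun i => x (i + n)

/-- A subshift: a closed, shift-invariant subset of the full shift. -/
def IsSubshift [TopologicalSpace A] (X : Set (ℤ → A)) : Prop :=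
  IsClosed X ∧ ∀ n : ℤ, ∀ x ∈ X, shiftMap n x ∈ X

/-- The block `u` (of length `p`) occurs in `X`. -/
def OccursIn {p : ℕ} (u : Fin p → A) (X : Set (ℤ → A)) : Prop :=
  ∃ x ∈ X, ∃ i : ℤ, ∀ j : Fin p, x (i + (j.1 : ℤ)) = u j

/-- A shift of finite type: a subshift determined by a set of allowed `k`-blocks. -/
def IsSFT [TopologicalSpace A] (X : Set (ℤ → A)) : Prop :=
  IsSubshift X ∧ ∃ (k : ℕ) (P : (Fin k → A) → Prop),
    X = {x | ∀ i : ℤ, P fun j => x (i + (j.1 : ℤ))}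

/-- A one-step shift of finite type: determined by allowed 2-blocks. -/
def IsOneStep [TopologicalSpace A] (X : Set (ℤ → A)) : Prop :=
  IsSubshift X ∧ ∃ T : A → A → Prop, X = {x | ∀ i : ℤ, T (x i) (x (i + 1))}

/-- Irreducibility: any two blocks of `X` can be seen in a single point of `X`,
the second occurring after the first. -/
def IrreducibleSubshift [TopologicalSpace A] (X : Set (ℤ → A)) : Prop :=
  ∀ (p q : ℕ) (u : Fin p → A) (w : Fin q → A),
    OccursIn u X → OccursIn w X →
      ∃ x ∈ X, ∃ i k : ℤ, i + (p : ℤ) ≤ k ∧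
        (∀ j : Fin p, x (i + (j.1 : ℤ)) = u j) ∧ ∀ j : Fin q, x (k + (j.1 : ℤ)) = w j

/-- A sliding block code: given by a local rule on a finite window. -/
def IsSlidingBlockCode (π : (ℤ → A) → ℤ → B) : Prop :=
  ∃ (r : ℕ) (Φ : (Fin (2 * r + 1) → A) → B),
    ∀ x i, π x i = Φ fun j => x (i - (r : ℤ) + (j.1 : ℤ))

/-- A one-block code. -/
def IsOneBlock (π : (ℤ → A) → ℤ → B) : Prop :=
  ∃ Φ : A → B, ∀ x i, π x i = Φ (x i)

/-- `Φ` is a one-block local rule for `π`. -/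
def OneBlockRule (π : (ℤ → A) → ℤ → B) (Φ : A → B) : Prop :=
  ∀ x i, π x i = Φ (x i)

/-- A factor code from `X` onto `Y`. -/
def IsFactorCode (X : Set (ℤ → A)) (Y : Set (ℤ → B)) (π : (ℤ → A) → ℤ → B) : Prop :=
  IsSlidingBlockCode π ∧ (∀ x ∈ X, π x ∈ Y) ∧ ∀ y ∈ Y, ∃ x ∈ X, π x = y

/-- A factor triple: a factor code from an SFT `X` onto the subshift `Y`. -/
def FactorTriple [TopologicalSpace A] [TopologicalSpace B]
    (X : Set (ℤ → A)) (Y : Set (ℤ → B)) (π : (ℤ → A) → ℤ → B) : Prop :=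
  IsSFT X ∧ IsSubshift Y ∧ IsFactorCode X Y π

/-- Transition `x → x'`: for each `n` there is `z` in the fiber agreeing with `x`
on `(-∞, n]` and with `x'` on `[i, ∞)` for some `i ≥ n`. -/
def TransitionTo (X : Set (ℤ → A)) (π : (ℤ → A) → ℤ → B) (x x' : ℤ → A) : Prop :=
  ∀ n : ℤ, ∃ z ∈ X, π z = π x ∧ (∀ m ≤ n, z m = x m) ∧
    ∃ i : ℤ, n ≤ i ∧ ∀ m : ℤ, i ≤ m → z m = x' m

/-- `x ~ x'`: transitions in both directions. -/
def TransEquiv (X : Set (ℤ → A)) (π : (ℤ → A) → ℤ → B) (x x' : ℤ → A) : Prop :=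
  TransitionTo X π x x' ∧ TransitionTo X π x' x

/-- The transition class of `x` (within the fiber of `π x`). -/
def transClass (X : Set (ℤ → A)) (π : (ℤ → A) → ℤ → B) (x : ℤ → A) : Set (ℤ → A) :=
  {x' | x' ∈ X ∧ π x' = π x ∧ TransEquiv X π x x'}

/-- The set of transition classes over `y`. -/
def transClassesOver (X : Set (ℤ → A)) (π : (ℤ → A) → ℤ → B) (y : ℤ → B) :
    Set (Set (ℤ → A)) :=
  {C | ∃ x, x ∈ X ∧ π x = y ∧ C = transClass X π x}

/-- Right transitive point: its forward orbit is dense in `X`. -/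
def RightTransitive (X : Set (ℤ → A)) (x : ℤ → A) : Prop :=
  x ∈ X ∧ ∀ z ∈ X, ∀ N : ℕ, ∃ n : ℤ, 0 ≤ n ∧ ∀ m : ℤ, |m| ≤ (N : ℤ) → x (m + n) = z m

/-- Left transitive point: its backward orbit is dense in `X`. -/
def LeftTransitive (X : Set (ℤ → A)) (x : ℤ → A) : Prop :=
  x ∈ X ∧ ∀ z ∈ X, ∀ N : ℕ, ∃ n : ℤ, n ≤ 0 ∧ ∀ m : ℤ, |m| ≤ (N : ℤ) → x (m + n) = z m

/-- Doubly transitive point. -/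
def DoublyTransitive (X : Set (ℤ → A)) (x : ℤ → A) : Prop :=
  RightTransitive X x ∧ LeftTransitive X x

def MutuallySeparated (x x' : ℤ → A) : Prop := ∀ i : ℤ, x i ≠ x' i

def RightAsymptotic (x x' : ℤ → A) : Prop := ∃ N : ℤ, ∀ m : ℤ, N ≤ m → x m = x' m

def LeftAsymptotic (x x' : ℤ → A) : Prop := ∃ N : ℤ, ∀ m : ℤ, m ≤ N → x m = x' m

/-- The class degree: the minimal number of transition classes over points of `Y`. -/
noncomputable def classDegree (X : Set (ℤ → A)) (Y : Set (ℤ → B))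
    (π : (ℤ → A) → ℤ → B) : ℕ :=
  sInf {d | ∃ y ∈ Y, Nat.card (transClassesOver X π y) = d}

/-- The preimage blocks of a `Y`-block `w` under the one-block rule `Φ`. -/
def blockPre (X : Set (ℤ → A)) (Φ : A → B) {p : ℕ} (w : Fin p → B) : Set (Fin p → A) :=
  {u | OccursIn u X ∧ ∀ j, Φ (u j) = w j}

/-- `u ∈ π⁻¹(w)` is routable through `a` at time `n`. -/
def Routable (X : Set (ℤ → A)) (Φ : A → B) {p : ℕ} (w : Fin (p + 1) → B)
    (u : Fin (p + 1) → A) (n : Fin (p + 1)) (a : A) : Prop :=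
  ∃ u' ∈ blockPre X Φ w, u' 0 = u 0 ∧ u' (Fin.last p) = u (Fin.last p) ∧ u' n = a

/-- `(w, n, M)` is a transition block. -/
def IsTransBlock (X : Set (ℤ → A)) (Y : Set (ℤ → B)) (Φ : A → B) {p : ℕ}
    (w : Fin (p + 1) → B) (n : Fin (p + 1)) (M : Set A) : Prop :=
  OccursIn w Y ∧ 0 < n.1 ∧ n.1 < p ∧ (∀ a ∈ M, Φ a = w n) ∧
    ∀ u ∈ blockPre X Φ w, ∃ a ∈ M, Routable X Φ w u n a

/-- `c*_π`: the minimal depth of a transition block. -/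
noncomputable def minDepth (X : Set (ℤ → A)) (Y : Set (ℤ → B)) (Φ : A → B) : ℕ :=
  sInf {d | ∃ (p : ℕ) (w : Fin (p + 1) → B) (n : Fin (p + 1)) (M : Set A),
    IsTransBlock X Y Φ w n M ∧ Nat.card M = d}

/-- A minimal transition block. -/
def IsMinTransBlock (X : Set (ℤ → A)) (Y : Set (ℤ → B)) (Φ : A → B) {p : ℕ}
    (w : Fin (p + 1) → B) (n : Fin (p + 1)) (M : Set A) : Prop :=
  IsTransBlock X Y Φ w n M ∧ Nat.card M = minDepth X Y Φ

/-- `d(w)`: the minimal number of symbols seen at a single coordinate among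
the preimages of `w`. -/
noncomputable def dval (X : Set (ℤ → A)) (Φ : A → B) {p : ℕ} (w : Fin p → B) : ℕ :=
  sInf {m | ∃ k : Fin p, Nat.card {a : A | ∃ u ∈ blockPre X Φ w, u k = a} = m}

/-- A magic block: a block of `Y` minimizing `d(·)`. -/
def IsMagicBlock (X : Set (ℤ → A)) (Y : Set (ℤ → B)) (Φ : A → B) {p : ℕ}
    (w : Fin (p + 1) → B) : Prop :=
  OccursIn w Y ∧
    dval X Φ w = sInf {m | ∃ (q : ℕ) (v : Fin (q + 1) → B), OccursIn v Y ∧ dval X Φ v = m}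

/-- An `(X̄, v̄)`-diamond: blocks `u, v` of `X` with the same image, same
endpoints, `u` occurring in `X̄` and `v̄` a subblock of `v`. -/
def IsDiamond (X Xbar : Set (ℤ → A)) (Φ : A → B) {q p : ℕ} (vbar : Fin q → A)
    (u v : Fin (p + 1) → A) : Prop :=
  OccursIn u Xbar ∧ OccursIn v X ∧ (∀ j, Φ (u j) = Φ (v j)) ∧
    (∃ (s : ℕ) (_ : s + q ≤ p + 1), ∀ j : Fin q,
      v ⟨s + j.1, by have := j.2; omega⟩ = vbar j) ∧
    u 0 = v 0 ∧ u (Fin.last p) = v (Fin.last p)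

/-- Reversed transition `x →_r x'`. -/
def RevTransitionTo (X : Set (ℤ → A)) (π : (ℤ → A) → ℤ → B) (x x' : ℤ → A) : Prop :=
  ∀ n : ℤ, ∃ z ∈ X, π z = π x ∧ (∀ m : ℤ, n ≤ m → z m = x' m) ∧
    ∃ i : ℤ, i ≤ n ∧ ∀ m ≤ i, z m = x m

def RevTransEquiv (X : Set (ℤ → A)) (π : (ℤ → A) → ℤ → B) (x x' : ℤ → A) : Prop :=
  RevTransitionTo X π x x' ∧ RevTransitionTo X π x' x

/-- The reversed transition class of `x`. -/
def revClass (X : Set (ℤ → A)) (π : (ℤ → A) → ℤ → B) (x : ℤ → A) : Set (ℤ → A) :=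
  {x' | x' ∈ X ∧ π x' = π x ∧ RevTransEquiv X π x x'}

open scoped Classical in
/-- The standard metric on the full shift. -/
noncomputable def shiftDist (x x' : ℤ → A) : ℝ :=
  if x = x' then 0
  else
    let k : ℕ := sInf {k : ℕ | x (k : ℤ) ≠ x' (k : ℤ) ∨ x (-(k : ℤ)) ≠ x' (-(k : ℤ))}
    (2 : ℝ) ^ (-(k : ℤ))

/-- Binary relations on `V`, with composition as multiplication. -/
def Rl (V : Type*) := V → V → Prop

instance rlMonoid {V : Type*} : Monoid (Rl V) where
  mul s t := fun a b => ∃ m, s a m ∧ t m b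
  one := fun a b => a = b
  mul_assoc s t w := by
    funext a b
    apply propext
    constructor
    · rintro ⟨m, ⟨n, h1, h2⟩, h3⟩
      exact ⟨n, h1, m, h2, h3⟩
    · rintro ⟨m, h1, n, h2, h3⟩
      exact ⟨n, ⟨m, h1, h2⟩, h3⟩
  one_mul s := by
    funext a b
    apply propext
    constructor
    · rintro ⟨m, h1, h2⟩
      have h1' : a = m := h1
      exact h1' ▸ h2
    · intro h
      exact ⟨a, rfl, h⟩
  mul_one s := by
    funext a b
    apply propext
    constructor
    · rintro ⟨m, h1, h2⟩
      have h2' : m = b := h2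
      exact h2' ▸ h1
    · intro h
      exact ⟨b, h, rfl⟩

theorem rl_mul {V : Type*} {s t : Rl V} {a b c : V} (h : s a b) (h' : t b c) : (s * t) a c :=
  ⟨b, h, h'⟩

theorem rl_mul_of {V : Type*} {s t w : Rl V} {a b c : V} (e : s * t = w) (h : s a b)
    (h' : t b c) : w a c :=
  e ▸ rl_mul h h'

instance rlFinite {V : Type*} [Finite V] : Finite (Rl V) :=
  inferInstanceAs (Finite (V → V → Prop))

theorem exists_idem_pow {M : Type*} [Monoid M] [Finite M] (s : M) :
    ∃ m : ℕ, 1 ≤ m ∧ s ^ m * s ^ m = s ^ m := by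
  obtain ⟨i, j, hij, h⟩ := Finite.exists_ne_map_eq_of_infinite (fun n : ℕ => s ^ n)
  wlog hlt : i < j generalizing i j
  · exact this j i hij.symm h.symm (by omega)
  obtain ⟨d, rfl⟩ : ∃ d, j = i + d := ⟨j - i, by omega⟩
  have hd : 1 ≤ d := by omega
  have h1 : ∀ n, i ≤ n → s ^ (n + d) = s ^ n := by
    intro n hn
    obtain ⟨e, rfl⟩ := Nat.exists_eq_add_of_le hn
    rw [show i + e + d = (i + d) + e by ring, pow_add, ← show s ^ i = s ^ (i + d) from h, ← pow_add]
  have h2 : ∀ q n, i ≤ n → s ^ (n + q * d) = s ^ n := by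
    intro q
    induction q with
    | zero => intro n _; simp
    | succ q ih =>
      intro n hn
      rw [show n + (q + 1) * d = (n + q * d) + d by ring, h1 _ (by omega), ih n hn]
  refine ⟨(i + 1) * d, by nlinarith, ?_⟩
  rw [← pow_add]
  exact h2 (i + 1) _ (by nlinarith)

theorem rl_fixed {V : Type*} [Finite V] {E : Rl V} (hE : E * E = E) {a b : V} (h : E a b) :
    ∃ f, E a f ∧ E f f ∧ E f b := by
  by_contra! hno
  have hsplit : ∀ c d, E c d → ∃ m, E c m ∧ E m d := by
    intro c d hcd
    rw [← hE] at hcd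
    exact hcd
  let W := {c : V // E a c ∧ E c b}
  let r : W → W → Prop := fun c d => E d.1 c.1
  have : IsTrans W r := 
    ⟨fun c d e (h1 : E d.1 c.1) (h2 : E e.1 d.1) =>
      show E e.1 c.1 from rl_mul_of hE h2 h1⟩
  have : Std.Irrefl r := ⟨fun c hc => hno c.1 c.2.1 hc c.2.2⟩
  have wf : WellFounded r := Finite.wellFounded_of_trans_of_irrefl r
  obtain ⟨m0, hm1, hm2⟩ := hsplit a b h
  obtain ⟨m, -, hm⟩ := wf.has_min Set.univ ⟨⟨m0, hm1, hm2⟩, trivial⟩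
  obtain ⟨m', h1, h2⟩ := hsplit m.1 b m.2.2
  exact hm ⟨m', rl_mul_of hE m.2.1 h1, h2⟩ trivial h1

theorem rl_pow_loop {V : Type*} {g : Rl V} {b : V} (h : g b b) (n : ℕ) : (g ^ n) b b := by
  induction n with
  | zero => rw [pow_zero]; exact rfl
  | succ n ih => rw [pow_succ]; exact rl_mul ih h

theorem rl_core {V : Type*} [Finite V] (S : Set (Rl V))
    (hmul : ∀ s ∈ S, ∀ t ∈ S, s * t ∈ S)
    (hstrong : ∀ s ∈ S, ∀ t ∈ S, ∀ a b c d, s a b → t c d → ∃ z ∈ S, z b c)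
    (hid : ∃ E ∈ S, E * E = E ∧ ∃ a b, E a b) :
    ∃ E ∈ S, (∃ a b, E a b) ∧ ∀ u ∈ S, ∀ a a2 b b2 c c2 e e2,
      E a a2 → E b b2 → u a2 c2 → u a2 e2 → u b2 e2 → E c2 c → E e2 e → (E * u * E) b c := by
  -- a primitive idempotent
  obtain ⟨E, hES, hEE, hE0, hprim⟩ : ∃ E ∈ S, E * E = E ∧ (∃ a b, E a b) ∧
      ∀ F ∈ S, F * F = F → (∃ a b, F a b) → E * F = F → F * E = F → F = E := by
    let I : Set (Rl V) := {E | E ∈ S ∧ E * E = E ∧ ∃ a b, E a b}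
    have hI : I.Nonempty := by
      obtain ⟨E, h1, h2, h3⟩ := hid
      exact ⟨E, h1, h2, h3⟩
    let fx : Rl V → ℕ := fun E => {Z : Rl V | E * Z = Z}.ncard
    obtain ⟨E, hEI, hmin⟩ := Set.exists_min_image I fx (Set.toFinite I) hI
    refine ⟨E, hEI.1, hEI.2.1, hEI.2.2, ?_⟩
    intro F hFS hFF hF0 hEF hFE
    have hle := hmin F ⟨hFS, hFF, hF0⟩
    have hsub : {Z : Rl V | F * Z = Z} ⊆ {Z : Rl V | E * Z = Z} := by
      intro Z hZ
      have hZ' : F * Z = Z := hZ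
      show E * Z = Z
      rw [← hZ', ← mul_assoc, hEF]
    have heq := Set.eq_of_subset_of_ncard_le hsub hle (Set.toFinite _)
    have : E ∈ {Z : Rl V | F * Z = Z} := by
      rw [heq]
      exact hEI.2.1
    have h' : F * E = E := this
    rw [← hFE, h']
  have hpowS : ∀ g ∈ S, ∀ n, E * g ^ n ∈ S := by
    intro g hg n
    induction n with
    | zero => simpa using hES
    | succ n ih => rw [pow_succ, ← mul_assoc]; exact hmul _ ih _ hg
  -- non-nilpotent elements of the local monoid have a power equal to `E`
  have hpow : ∀ g ∈ S, E * g = g → g * E = g → ∀ b, g b b → ∃ m, g ^ (m + 1) = E := by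
    intro g hg h1 h2 b hb
    obtain ⟨m, hm, hi⟩ := exists_idem_pow g
    obtain ⟨m, rfl⟩ : ∃ m', m = m' + 1 := ⟨m - 1, by omega⟩
    have e1 : E * g ^ (m + 1) = g ^ (m + 1) := by rw [pow_succ', ← mul_assoc, h1]
    have e2 : g ^ (m + 1) * E = g ^ (m + 1) := by rw [pow_succ, mul_assoc, h2]
    refine ⟨m, hprim _ ?_ hi ⟨b, b, rl_pow_loop hb _⟩ e1 e2⟩
    rw [← e1]
    exact hpowS g hg _
  have hsymm : ∀ a b, E a b → E a a → E b b → E b a := by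
    intro a b hab haa hbb
    obtain ⟨z, hzS, hz⟩ := hstrong E hES E hES b b a a hbb haa
    have hba : (E * z * E) b a := rl_mul (rl_mul hbb hz) haa
    have hb : (E * z * E) b b := rl_mul (rl_mul hbb hz) hab
    obtain ⟨m, hm⟩ := hpow (E * z * E) (hmul _ (hmul _ hES _ hzS) _ hES)
      (by rw [← mul_assoc, ← mul_assoc, hEE]) (by rw [mul_assoc, hEE]) b hb
    rw [← hm, pow_succ]
    exact rl_mul (rl_pow_loop hb m) hba
  have hinv : ∀ g ∈ S, E * g = g → g * E = g → ∀ f f', g f f' → E f f → E f' f' →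
      ∃ k, g * k = E ∧ k f' f := by
    intro g hg h1 h2 f f' hff hf hf'
    obtain ⟨z, hzS, hz⟩ := hstrong E hES E hES f' f' f f hf' hf
    have hg'S : g * (z * E) ∈ S := hmul _ hg _ (hmul _ hzS _ hES)
    obtain ⟨m, hm⟩ := hpow (g * (z * E)) hg'S (by rw [← mul_assoc, h1])
      (by rw [mul_assoc, mul_assoc, hEE]) f (rl_mul hff (rl_mul hz hf))
    set g' := g * (z * E) with hg'
    let k := E * z * (E * g' ^ m) * E
    have hkS : k ∈ S := hmul _ (hmul _ (hmul _ hES _ hzS) _ (hpowS g' hg'S m)) _ hES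
    have hgk : g * k = E := by
      calc g * k = (g * E) * (z * E) * g' ^ m * E := by simp only [k, mul_assoc]
        _ = g' ^ (m + 1) * E := by rw [h2, ← hg', pow_succ']
        _ = E := by rw [hm, hEE]
    have hEk : E * k = k := by
      simp only [k, ← mul_assoc]
      rw [hEE]
    have hkE : k * E = k := by
      simp only [k, mul_assoc]
      rw [hEE]
    have hkg : k * g = E := by
      apply hprim _ (hmul _ hkS _ hg)
      · calc k * g * (k * g) = k * (g * k) * g := by simp only [mul_assoc]
          _ = k * g := by rw [hgk, hkE]
      · have : (g * (k * g) * k) f f := by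
          have e : g * (k * g) * k = (g * k) * (g * k) := by simp only [mul_assoc]
          rw [e, hgk, hEE]
          exact hf
        obtain ⟨m1, ⟨m2, _, h⟩, _⟩ := this
        exact ⟨m2, m1, h⟩
      · rw [← mul_assoc, hEk]
      · rw [mul_assoc, h2]
    refine ⟨k, hgk, ?_⟩
    have : (g * k) f f := by
      rw [hgk]
      exact hf
    obtain ⟨h, hfh, hhf⟩ := this
    rw [← hEk] at hhf
    obtain ⟨l, hhl, hlf⟩ := hhf
    obtain ⟨f0, h01, h02, h03⟩ := rl_fixed hEE hhl
    have hf0 : k f0 f := rl_mul_of hEk h03 hlf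
    have : E f0 f' := rl_mul_of hkg hf0 hff
    exact rl_mul_of hEk (hsymm f0 f' this h02 hf') hf0
  refine ⟨E, hES, hE0, ?_⟩
  intro u hu a a2 b b2 c c2 e e2 ha hb hac hae hbe hc he
  obtain ⟨f, hf1, hf2, hf3⟩ := rl_fixed hEE ha
  obtain ⟨f', hf1', hf2', hf3'⟩ := rl_fixed hEE he
  have hgS : E * u * E ∈ S := hmul _ (hmul _ hES _ hu) _ hES
  have hg1 : E * (E * u * E) = E * u * E := by rw [← mul_assoc, ← mul_assoc, hEE]
  have hg2 : (E * u * E) * E = E * u * E := by rw [mul_assoc, hEE]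
  obtain ⟨k, hgk, hk⟩ := hinv (E * u * E) hgS hg1 hg2 f f'
    (rl_mul (rl_mul hf3 hae) hf1') hf2 hf2'
  have h1 : (E * u * E) b f' := rl_mul (rl_mul hb hbe) hf1'
  have h2 : (E * u * E) f c := rl_mul (rl_mul hf3 hac) hc
  have h3 : E b f := rl_mul_of hgk h1 hk
  exact rl_mul_of hg1 h3 h2

/-- The window of length `L` of `z` starting at `t`. -/
def win (L : ℕ) (z : ℤ → A) (t : ℤ) : Fin L → A := fun j => z (t + (j.1 : ℤ))

theorem win_eq_iff {L : ℕ} {z z' : ℤ → A} {t t' : ℤ} :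
    win L z t = win L z' t' ↔ ∀ i : ℤ, 0 ≤ i → i < L → z (t + i) = z' (t' + i) := by
  constructor
  · intro h i h0 h1
    obtain ⟨n, rfl⟩ := Int.eq_ofNat_of_zero_le h0
    exact congrFun h ⟨n, by omega⟩
  · intro h
    funext j
    exact h j.1 (by omega) (by have := j.2; omega)

/-- Gluing data: points of `X` sharing an `L`-window can be spliced. -/
def Glue (X : Set (ℤ → A)) (π : (ℤ → A) → ℤ → B) (L r : ℕ) : Prop :=
  ∀ z ∈ X, ∀ z' ∈ X, ∀ t : ℤ, win L z t = win L z' t →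
    ∃ s ∈ X, (∀ m, m < t + L → s m = z m) ∧ (∀ m, t ≤ m → s m = z' m) ∧
      (∀ i, i < t → π s (i + r) = π z (i + r)) ∧ ∀ i, t ≤ i → π s (i + r) = π z' (i + r)

theorem glue_of (X : Set (ℤ → A)) (π : (ℤ → A) → ℤ → B) (k r L : ℕ) (hL : L = k + 2 * r + 1)
    (P : (Fin k → A) → Prop) (hX : X = {x | ∀ i : ℤ, P fun j => x (i + (j.1 : ℤ))})
    (Φ : (Fin (2 * r + 1) → A) → B)
    (hΦ : ∀ x i, π x i = Φ fun j => x (i - (r : ℤ) + (j.1 : ℤ))) : Glue X π L r := by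
  intro z hz z' hz' t ht
  rw [win_eq_iff] at ht
  let s : ℤ → A := fun m => if m < t + L then z m else z' m
  have hs1 : ∀ m, m < t + L → s m = z m := fun m hm => if_pos hm
  have hs2 : ∀ m, t ≤ m → s m = z' m := by
    intro m hm
    by_cases h : m < t + L
    · rw [hs1 m h]
      have := ht (m - t) (by omega) (by omega)
      simpa using this
    · exact if_neg h
  refine ⟨s, ?_, hs1, hs2, ?_, ?_⟩
  · rw [hX] at hz hz' ⊢
    intro i
    by_cases h : i < t
    · have e : (fun j : Fin k => s (i + (j.1 : ℤ))) = fun j => z (i + (j.1 : ℤ)) := by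
        funext j
        exact hs1 _ (by have := j.2; omega)
      rw [e]
      exact hz i
    · have e : (fun j : Fin k => s (i + (j.1 : ℤ))) = fun j => z' (i + (j.1 : ℤ)) := by
        funext j
        exact hs2 _ (by omega)
      rw [e]
      exact hz' i
  · intro i hi
    rw [hΦ, hΦ]
    congr 1
    funext j
    exact hs1 _ (by have := j.2; omega)
  · intro i hi
    rw [hΦ, hΦ]
    congr 1
    funext j
    exact hs2 _ (by omega)

/-- The relation: there is a point of `X` from window `a` at time `p` to window `b` at time `q`,
whose image reads `f` in between. -/
def Qr (X : Set (ℤ → A)) (π : (ℤ → A) → ℤ → B) (L r : ℕ) (f : ℤ → B) (p q : ℤ) :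
    Rl (Fin L → A) :=
  fun a b => ∃ z ∈ X, win L z p = a ∧ win L z q = b ∧ ∀ i, p ≤ i → i < q → π z (i + r) = f i

theorem Qr_congr (X : Set (ℤ → A)) (π : (ℤ → A) → ℤ → B) (L r : ℕ) (f f' : ℤ → B) (p q : ℤ)
    (h : ∀ i, p ≤ i → i < q → f i = f' i) : Qr X π L r f p q = Qr X π L r f' p q := by
  funext a b
  apply propext
  constructor
  · rintro ⟨z, hz, h1, h2, h3⟩
    exact ⟨z, hz, h1, h2, fun i hi hi' => (h3 i hi hi').trans (h i hi hi')⟩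
  · rintro ⟨z, hz, h1, h2, h3⟩
    exact ⟨z, hz, h1, h2, fun i hi hi' => (h3 i hi hi').trans (h i hi hi').symm⟩

theorem Qr_mul (X : Set (ℤ → A)) (π : (ℤ → A) → ℤ → B) (L r : ℕ) (hG : Glue X π L r)
    (f : ℤ → B) (p q s : ℤ) (hpq : p ≤ q) (hqs : q ≤ s) :
    Qr X π L r f p q * Qr X π L r f q s = Qr X π L r f p s := by
  funext a b
  apply propext
  constructor
  · rintro ⟨m, ⟨z, hz, h1, h2, h3⟩, ⟨z', hz', h1', h2', h3'⟩⟩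
    obtain ⟨w, hw, e1, e2, e3, e4⟩ := hG z hz z' hz' q (h2.trans h1'.symm)
    refine ⟨w, hw, ?_, ?_, ?_⟩
    · rw [← h1, win_eq_iff]
      intro i hi hi'
      exact e1 _ (by omega)
    · rw [← h2', win_eq_iff]
      intro i hi hi'
      exact e2 _ (by omega)
    · intro i hi hi'
      by_cases h : i < q
      · rw [e3 i h, h3 i hi h]
      · rw [e4 i (by omega), h3' i (by omega) hi']
  · rintro ⟨z, hz, h1, h2, h3⟩
    exact ⟨win L z q, ⟨z, hz, h1, rfl, fun i hi hi' => h3 i hi (by omega)⟩,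
      ⟨z, hz, rfl, h2, fun i hi hi' => h3 i (by omega) hi'⟩⟩

theorem Qr_shift (X : Set (ℤ → A)) (π : (ℤ → A) → ℤ → B) (L r : ℕ)
    (hS : ∀ n : ℤ, ∀ x ∈ X, shiftMap n x ∈ X)
    (hπ : ∀ x (n i : ℤ), π (shiftMap n x) i = π x (i + n))
    (f : ℤ → B) (p q m : ℤ) :
    Qr X π L r (fun i => f (i + m)) p q = Qr X π L r f (p + m) (q + m) := by
  funext a b
  apply propext
  constructor
  · rintro ⟨z, hz, h1, h2, h3⟩
    refine ⟨shiftMap (-m) z, hS _ _ hz, ?_, ?_, ?_⟩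
    · rw [← h1, win_eq_iff]
      intro i _ _
      simp only [shiftMap]
      congr 1
      ring
    · rw [← h2, win_eq_iff]
      intro i _ _
      simp only [shiftMap]
      congr 1
      ring
    · intro i hi hi'
      rw [hπ]
      have := h3 (i - m) (by omega) (by omega)
      rw [show i + r + -m = i - m + r by ring, this]
      simp
  · rintro ⟨z, hz, h1, h2, h3⟩
    refine ⟨shiftMap m z, hS _ _ hz, ?_, ?_, ?_⟩
    · rw [← h1, win_eq_iff]
      intro i _ _
      simp only [shiftMap]
      congr 1
      ring
    · rw [← h2, win_eq_iff]
      intro i _ _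
      simp only [shiftMap]
      congr 1
      ring
    · intro i hi hi'
      rw [hπ]
      have := h3 (i + m) (by omega) (by omega)
      rw [show i + r + m = i + m + r by ring, this]

theorem no_transition_between_distinct_classes [Fintype A] [TopologicalSpace A] [DiscreteTopology A]
    [Fintype B] [TopologicalSpace B] [DiscreteTopology B]
    (X : Set (ℤ → A)) (Y : Set (ℤ → B)) (π : (ℤ → A) → ℤ → B)
    (hT : FactorTriple X Y π) (hXirr : IrreducibleSubshift X)
    (y : ℤ → B) (hy : RightTransitive Y y)
    (x x' : ℤ → A) (hx : x ∈ X) (hx' : x' ∈ X)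
    (hpx : π x = y) (hpx' : π x' = y) (hne : ¬ TransEquiv X π x x') :
    ¬ TransitionTo X π x x' := by
  intro hxx
  apply hne
  refine ⟨hxx, ?_⟩
  obtain ⟨⟨⟨-, hS⟩, k, P, hXP⟩, ⟨-, hYS⟩, ⟨r, Φ, hΦ⟩, hXY, -⟩ := hT
  obtain ⟨L, hL⟩ : ∃ L, L = k + 2 * r + 1 := ⟨_, rfl⟩
  have hG : Glue X π L r := glue_of X π k r L hL P hXP Φ hΦ
  have hπ : ∀ x (n i : ℤ), π (shiftMap n x) i = π x (i + n) := by
    intro x n i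
    rw [hΦ, hΦ]
    congr 1
    funext j
    simp only [shiftMap]
    congr 1
    ring
  let S : Set (Rl (Fin L → A)) := {s | ∃ f p q, p ≤ q ∧ s = Qr X π L r f p q}
  have hmul : ∀ s ∈ S, ∀ t ∈ S, s * t ∈ S := by
    rintro s ⟨f, p, q, hpq, rfl⟩ t ⟨f', p', q', hpq', rfl⟩
    refine ⟨fun i => if i < q then f i else f' (i + (p' - q)), p, q + (q' - p'), by omega, ?_⟩
    rw [← Qr_mul X π L r hG _ p q (q + (q' - p')) hpq (by omega)]
    congr 1
    · apply Qr_congr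
      intro i _ hi
      rw [if_pos hi]
    · have := Qr_shift X π L r hS hπ f' q (q + (q' - p')) (p' - q)
      rw [show q + (p' - q) = p' by ring, show q + (q' - p') + (p' - q) = q' by ring] at this
      rw [← this]
      apply Qr_congr
      intro i hi _
      rw [if_neg (by omega)]
  have hstrong : ∀ s ∈ S, ∀ t ∈ S, ∀ a b c d, s a b → t c d → ∃ z ∈ S, z b c := by
    rintro s ⟨f, p, q, hpq, rfl⟩ t ⟨f', p', q', hpq', rfl⟩ a b c d ⟨z, hz, -, hb, -⟩
      ⟨z', hz', hc, -, -⟩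
    obtain ⟨w, hw, i, l, hil, h1, h2⟩ := hXirr L L b c
      ⟨z, hz, q, fun j => congrFun hb j⟩ ⟨z', hz', p', fun j => congrFun hc j⟩
    exact ⟨_, ⟨fun m => π w (m + r), i, l, by omega, rfl⟩, w, hw, funext h1, funext h2,
      fun _ _ _ => rfl⟩
  obtain ⟨E, ⟨f, p, q, hpq, hE⟩, ⟨a0, b0, h0⟩, hcore⟩ := rl_core S hmul hstrong
    ⟨Qr X π L r (fun i => y i) 0 0, ⟨_, 0, 0, le_refl _, rfl⟩,
      Qr_mul X π L r hG _ 0 0 0 (le_refl _) (le_refl _),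
      win L x 0, win L x 0, x, hx, rfl, rfl, fun i h h' => by omega⟩
  rw [hE] at h0
  obtain ⟨z0, hz0, -, -, hf⟩ := h0
  obtain ⟨y', hy'⟩ : ∃ y' : ℤ → B, y' = fun i => y (i + r) := ⟨_, rfl⟩
  -- the word of `E` occurs arbitrarily far to the right in `y`
  have hocc : ∀ N : ℤ, ∃ p1 q1, N ≤ p1 ∧ p1 ≤ q1 ∧ E = Qr X π L r y' p1 q1 := by
    intro N
    obtain ⟨n, hn, hm⟩ := hy.2 _ (hYS (p - N) _ (hXY z0 hz0)) (N.natAbs + (q - p).natAbs + r)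
    refine ⟨N + n, q - p + N + n, by omega, by omega, ?_⟩
    rw [hE]
    have := Qr_shift X π L r hS hπ y' p q (N - p + n)
    rw [show p + (N - p + n) = N + n by ring,
      show q + (N - p + n) = q - p + N + n by ring] at this
    rw [← this]
    apply Qr_congr
    intro i hi hi'
    have h1 := hm (i + r + N - p) (by rw [abs_le]; omega)
    simp only [shiftMap] at h1
    rw [show i + r + N - p + (p - N) = i + r by ring, hf i hi hi'] at h1
    rw [← h1, hy']
    simp only
    congr 1
    ring
  have hself : ∀ z ∈ X, π z = y → ∀ s t, Qr X π L r y' s t (win L z s) (win L z t) := by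
    intro z hz hzy s t
    refine ⟨z, hz, rfl, rfl, ?_⟩
    intro i _ _
    rw [hzy, hy']
  intro n
  obtain ⟨p1, q1, hn1, hpq1, hE1⟩ := hocc n
  obtain ⟨z, hz, hzy, hzx, i, hi, hzx'⟩ := hxx (q1 + L)
  obtain ⟨p2, q2, hn2, hpq2, hE2⟩ := hocc i
  have hEx : ∀ z ∈ X, π z = y → E (win L z p1) (win L z q1) := by
    intro z hz hzy
    rw [hE1]
    exact hself z hz hzy _ _
  have hEx2 : ∀ z ∈ X, π z = y → E (win L z p2) (win L z q2) := by
    intro z hz hzy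
    rw [hE2]
    exact hself z hz hzy _ _
  have hcross : Qr X π L r y' q1 p2 (win L x q1) (win L x' p2) := by
    have e1 : win L x q1 = win L z q1 := by
      rw [win_eq_iff]
      intro j _ _
      exact (hzx _ (by omega)).symm
    have e2 : win L x' p2 = win L z p2 := by
      rw [win_eq_iff]
      intro j _ _
      exact (hzx' _ (by omega)).symm
    rw [e1, e2]
    exact hself z hz (hzy.trans hpx) _ _
  have key := hcore (Qr X π L r y' q1 p2) ⟨y', q1, p2, by omega, rfl⟩ _ _ _ _ _ _ _ _
    (hEx x hx hpx) (hEx x' hx' hpx') (hself x hx hpx _ _) hcross (hself x' hx' hpx' _ _)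
    (hEx2 x hx hpx) (hEx2 x' hx' hpx')
  have hprod : E * Qr X π L r y' q1 p2 * E = Qr X π L r y' p1 q2 := by
    nth_rewrite 1 [hE1]
    rw [hE2, Qr_mul X π L r hG y' p1 q1 p2 hpq1 (by omega),
      Qr_mul X π L r hG y' p1 p2 q2 (by omega) hpq2]
  rw [hprod] at key
  obtain ⟨v, hv, hv1, hv2, hv3⟩ := key
  obtain ⟨s, hs, s1, s2, s3, s4⟩ := hG x' hx' v hv p1 hv1.symm
  have hsx : win L s q2 = win L x q2 := by
    rw [← hv2, win_eq_iff]
    intro j _ _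
    exact s2 _ (by omega)
  obtain ⟨t, ht, t1, t2, t3, t4⟩ := hG s hs x hx q2 hsx
  refine ⟨t, ht, ?_, ?_, q2, by omega, t2⟩
  · rw [hpx']
    funext j
    obtain ⟨m, rfl⟩ : ∃ m, j = m + r := ⟨j - r, by ring⟩
    by_cases h2 : m < q2
    · rw [t3 m h2]
      by_cases h1 : m < p1
      · rw [s3 m h1, hpx']
      · rw [s4 m (by omega), hv3 m (by omega) h2, hy']
    · rw [t4 m (by omega), hpx]
  · intro m hm
    rw [t1 m (by omega), s1 m (by omega)]
end

section
/- Let (X, Y, π) be an irreducible factor triple with X one-step and π one-block, let (w, n, M) be a minimal transition block, and let y ∈ Y be right transitive with y_{[i, i+|w|)} = w. Then for each transition class C over y there is a unique symbol b ∈ M such that every point of C is routable through b at time i + n; moreover |C|_{i+n} ∩ M| = 1, where C|_{i+n} = { x_{i+n} : x ∈ C }. -/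
open Set

universe u v uc

variable {A : Type u} {B : Type v}

/-- `a` at time `s` can be connected to `b` at time `t` by a path over `y`. -/
def Conn (X : Set (ℤ → A)) (Φ : A → B) (y : ℤ → B) (s t : ℤ) (a b : A) : Prop :=
  ∃ x ∈ X, x s = a ∧ x t = b ∧ ∀ m, s ≤ m → m ≤ t → Φ (x m) = y m

/-- `w` occurs in `y` with its `n`-th letter at time `t`. -/
def WAt {p : ℕ} (w : Fin (p + 1) → B) (n : Fin (p + 1)) (y : ℤ → B) (t : ℤ) : Prop :=
  ∀ j : Fin (p + 1), y (t - (n.1 : ℤ) + (j.1 : ℤ)) = w j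

theorem splice_mem [TopologicalSpace A] {X : Set (ℤ → A)} (hX1 : IsOneStep X)
    {x x' : ℤ → A} (hx : x ∈ X) (hx' : x' ∈ X) (m : ℤ) (h : x m = x' m) :
    (fun k => if k ≤ m then x k else x' k) ∈ X := by
  obtain ⟨_, T, rfl⟩ := hX1
  intro i
  have h1 := hx i
  have h2 := hx' i
  (try dsimp only)
  rcases lt_trichotomy i m with h3 | h3 | h3
  · rw [if_pos (by omega), if_pos (by omega)]; exact h1
  · subst h3
    rw [if_pos le_rfl, if_neg (by omega), h]; exact h2
  · rw [if_neg (by omega), if_neg (by omega)]; exact h2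

theorem periodic_mem [TopologicalSpace A] {X : Set (ℤ → A)} (hX1 : IsOneStep X)
    {z : ℤ → A} (hz : z ∈ X) (i c N : ℤ) (hN : 0 < N) (h : z (i + N) = z i) :
    (fun m => z (i + (m - c) % N)) ∈ X := by
  obtain ⟨_, T, rfl⟩ := hX1
  intro m
  (try dsimp only)
  have h0 := Int.emod_nonneg (m - c) hN.ne'
  have h1 := Int.emod_lt_of_pos (m - c) hN
  have h2 : (m + 1 - c) % N = ((m - c) % N + 1) % N := by
    rw [Int.emod_add_emod]; congr 1; ring
  have h3 := hz (i + (m - c) % N)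
  by_cases h4 : (m - c) % N + 1 < N
  · rw [h2, Int.emod_eq_of_lt (by omega) h4, ← add_assoc]; exact h3
  · have h5 : (m - c) % N + 1 = N := by omega
    rw [h2, h5, Int.emod_self, add_zero, ← h]
    rw [add_assoc, h5] at h3; exact h3

theorem Conn.trans [TopologicalSpace A] {X : Set (ℤ → A)} (hX1 : IsOneStep X)
    {Φ : A → B} {y : ℤ → B} {s t r : ℤ} {a b c : A} (hst : s ≤ t) (htr : t ≤ r)
    (h1 : Conn X Φ y s t a b) (h2 : Conn X Φ y t r b c) : Conn X Φ y s r a c := by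
  obtain ⟨x, hx, hs, ht, ho⟩ := h1
  obtain ⟨x', hx', hs', ht', ho'⟩ := h2
  refine ⟨_, splice_mem hX1 hx hx' t (by rw [ht, hs']), ?_, ?_, ?_⟩
  · simp [hst, hs]
  · (try dsimp only)
    split_ifs with h
    · have : r = t := by omega
      subst this; rw [ht, ← hs', ht']
    · exact ht'
  · intro m h1 h2
    (try dsimp only)
    split_ifs with h
    · exact ho m h1 h
    · exact ho' m (by omega) h2

theorem Conn.congr {X : Set (ℤ → A)} {Φ : A → B} {y y' : ℤ → B} {s t : ℤ} {a b : A}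
    (h : Conn X Φ y s t a b) (hy : ∀ m, s ≤ m → m ≤ t → y' m = y m) :
    Conn X Φ y' s t a b := by
  obtain ⟨x, hx, hs, ht, ho⟩ := h
  exact ⟨x, hx, hs, ht, fun m h1 h2 => by rw [ho m h1 h2, hy m h1 h2]⟩

theorem Conn.shift [TopologicalSpace A] {X : Set (ℤ → A)} (hX1 : IsOneStep X)
    {Φ : A → B} {y : ℤ → B} {s t : ℤ} {a b : A} (N : ℤ)
    (hy : ∀ m, y (m + N) = y m) (h : Conn X Φ y s t a b) :
    Conn X Φ y (s + N) (t + N) a b := by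
  obtain ⟨x, hx, hs, ht, ho⟩ := h
  refine ⟨shiftMap (-N) x, hX1.1.2 _ _ hx, ?_, ?_, ?_⟩
  · simpa [shiftMap] using hs
  · simpa [shiftMap] using ht
  · intro m h1 h2
    have := hy (m + -N)
    rw [neg_add_cancel_right] at this
    rw [this]
    exact ho _ (by omega) (by omega)

/-- Routability in terms of connections. -/
theorem routable_iff_conn [TopologicalSpace A] {X : Set (ℤ → A)} (hX1 : IsOneStep X)
    {Φ : A → B} {p : ℕ} {w : Fin (p + 1) → B} {n : Fin (p + 1)} {y : ℤ → B} {i : ℤ}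
    (hw : ∀ j : Fin (p + 1), y (i + (j.1 : ℤ)) = w j) (u : Fin (p + 1) → A) (c : A) :
    Routable X Φ w u n c ↔
      Conn X Φ y i (i + (n.1 : ℤ)) (u 0) c ∧
        Conn X Φ y (i + (n.1 : ℤ)) (i + (p : ℤ)) c (u (Fin.last p)) := by
  have hn : n.1 ≤ p := Nat.lt_succ_iff.mp n.2
  constructor
  · rintro ⟨u', ⟨⟨x, hx, k, hk⟩, hΦ⟩, h0, hl, hc⟩
    have hx' : shiftMap (k - i) x ∈ X := hX1.1.2 _ _ hx
    have hj : ∀ j : Fin (p + 1), shiftMap (k - i) x (i + (j.1 : ℤ)) = u' j := by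
      intro j
      rw [← hk j]; simp only [shiftMap]; congr 1; ring
    have ho : ∀ m, i ≤ m → m ≤ i + p → Φ (shiftMap (k - i) x m) = y m := by
      intro m h1 h2
      have h3 := hj ⟨(m - i).toNat, by omega⟩
      have h4 := hw ⟨(m - i).toNat, by omega⟩
      have h5 : i + (((m - i).toNat : ℕ) : ℤ) = m := by omega
      simp only [h5] at h3 h4
      rw [h3, h4, hΦ]
    have e0 : shiftMap (k - i) x i = u 0 := by
      rw [← h0, ← hj 0]; simp
    have el : shiftMap (k - i) x (i + p) = u (Fin.last p) := by
      rw [← hl, ← hj (Fin.last p)]; simp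
    have en : shiftMap (k - i) x (i + (n.1 : ℤ)) = c := by rw [hj n, hc]
    exact ⟨⟨_, hx', e0, en, fun m h1 h2 => ho m h1 (by omega)⟩,
      ⟨_, hx', en, el, fun m h1 h2 => ho m (by omega) h2⟩⟩
  · rintro ⟨⟨x, hx, hs, ht, ho⟩, ⟨x', hx', hs', ht', ho'⟩⟩
    refine ⟨fun j => if i + (j.1 : ℤ) ≤ i + (n.1 : ℤ) then x (i + j.1) else x' (i + j.1),
      ⟨⟨_, splice_mem hX1 hx hx' (i + (n.1 : ℤ)) (by rw [ht, hs']), i, fun j => rfl⟩, ?_⟩,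
      ?_, ?_, ?_⟩
    · intro j
      have := j.2
      (try dsimp only)
      rw [← hw j]
      split_ifs with h
      · exact ho _ (by omega) h
      · exact ho' _ (by omega) (by omega)
    · simp [hs]
    · simp only [Fin.val_last]
      split_ifs with h
      · have : (p : ℤ) = n.1 := by omega
        rw [← ht', this, ht, hs']
      · exact ht'
    · simp [ht]

/-- Routing through `M`. -/
theorem conn_route [TopologicalSpace A] {X : Set (ℤ → A)} {Y : Set (ℤ → B)}
    (hX1 : IsOneStep X) {Φ : A → B} {p : ℕ} {w : Fin (p + 1) → B} {n : Fin (p + 1)}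
    {M : Set A} (hB : IsTransBlock X Y Φ w n M) {y : ℤ → B} {s t r : ℤ}
    (hw : WAt w n y t) (hs : s ≤ t - n.1) (hr : t - n.1 + p ≤ r) {a b : A}
    (h : Conn X Φ y s r a b) :
    ∃ c ∈ M, Conn X Φ y s t a c ∧ Conn X Φ y t r c b := by
  obtain ⟨x, hx, ha, hb, ho⟩ := h
  obtain ⟨c, hc, hR⟩ := hB.2.2.2.2 (fun j => x (t - n.1 + (j.1 : ℤ)))
    ⟨⟨x, hx, _, fun j => rfl⟩, fun j => by
      have := j.2
      rw [ho _ (by omega) (by omega)]; exact hw j⟩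
  rw [routable_iff_conn hX1 hw] at hR
  have hn := hB.2.2.1
  simp only [Fin.val_zero, Fin.val_last, sub_add_cancel] at hR
  refine ⟨c, hc, ?_, ?_⟩
  · exact Conn.trans hX1 hs (by omega)
      ⟨x, hx, ha, by simp, fun m h1 h2 => ho m h1 (by omega)⟩ hR.1
  · exact Conn.trans hX1 (by omega) hr hR.2
      ⟨x, hx, rfl, hb, fun m h1 h2 => ho m (by omega) h2⟩

/-- Minimality: each symbol of `M` is indispensable. -/
theorem conn_min [Fintype A] [TopologicalSpace A] {X : Set (ℤ → A)} {Y : Set (ℤ → B)}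
    (hX1 : IsOneStep X) {Φ : A → B} {p : ℕ} {w : Fin (p + 1) → B} {n : Fin (p + 1)}
    {M : Set A} (hB : IsMinTransBlock X Y Φ w n M) {y : ℤ → B} (hy : y ∈ Y) {s t r : ℤ}
    (hw : WAt w n y t) (hs : s ≤ t - n.1) (hr : t - n.1 + p ≤ r) {c : A} (hc : c ∈ M) :
    ∃ a b, Conn X Φ y s t a c ∧ Conn X Φ y t r c b ∧
      ∀ c' ∈ M, Conn X Φ y s t a c' → Conn X Φ y t r c' b → c' = c := by
  by_contra! hcon
  have hn0 := hB.1.2.1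
  have hnp := hB.1.2.2.1
  have ep : (((r - s).toNat : ℕ) : ℤ) = r - s := by omega
  have en : (((t - s).toNat : ℕ) : ℤ) = t - s := by omega
  have key : IsTransBlock X Y Φ (p := (r - s).toNat) (fun j => y (s + (j.1 : ℤ)))
      ⟨(t - s).toNat, by omega⟩ (M \ {c}) := by
    refine ⟨⟨y, hy, s, fun j => rfl⟩, by simp only; omega, by simp only; omega, ?_, ?_⟩
    · intro a ha
      have h1 := hB.1.2.2.2.1 a ha.1
      have h2 := hw n
      rw [sub_add_cancel] at h2
      simp only [en, add_sub_cancel, h1, h2]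
    · rintro u ⟨⟨x, hx, k, hk⟩, hΦ⟩
      have hC : Conn X Φ y s r (u 0) (u (Fin.last _)) := by
        refine ⟨shiftMap (k - s) x, hX1.1.2 _ _ hx, ?_, ?_, ?_⟩
        · rw [← hk 0]; simp [shiftMap]
        · rw [← hk (Fin.last _)]; simp only [shiftMap, Fin.val_last]; congr 1; omega
        · intro m h1 h2
          have h3 := hk ⟨(m - s).toNat, by omega⟩
          have h4 := hΦ ⟨(m - s).toNat, by omega⟩
          have e1 : m + (k - s) = k + (((m - s).toNat : ℕ) : ℤ) := by omega
          have e2 : s + (((m - s).toNat : ℕ) : ℤ) = m := by omega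
          simp only [e2] at h4
          simp only [shiftMap]
          rw [e1, h3, h4]
      have hres : ∃ c' ∈ M, c' ≠ c ∧ Conn X Φ y s t (u 0) c' ∧
          Conn X Φ y t r c' (u (Fin.last _)) := by
        obtain ⟨c', hc', h1, h2⟩ := conn_route hX1 hB.1 hw hs hr hC
        by_cases h : c' = c
        · subst h
          obtain ⟨c'', h3, h4, h5, h6⟩ := hcon _ _ h1 h2
          exact ⟨c'', h3, h6, h4, h5⟩
        · exact ⟨c', hc', h, h1, h2⟩
      obtain ⟨c', hc', hne, h1, h2⟩ := hres
      refine ⟨c', ⟨hc', hne⟩, ?_⟩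
      rw [routable_iff_conn (y := y) (i := s) hX1 (fun j => rfl)]
      simp only [en, ep, add_sub_cancel]
      exact ⟨h1, h2⟩
  have h1 : minDepth X Y Φ ≤ Nat.card (M \ {c} : Set A) :=
    Nat.sInf_le ⟨_, _, _, _, key, rfl⟩
  rw [← hB.2, Nat.card_coe_set_eq, Nat.card_coe_set_eq] at h1
  have := Set.ncard_sdiff_singleton_lt_of_mem hc (Set.toFinite M)
  omega

/-- Minimality between two other occurrences of `w`. -/
theorem conn_min' [Fintype A] [TopologicalSpace A] {X : Set (ℤ → A)} {Y : Set (ℤ → B)}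
    (hX1 : IsOneStep X) {Φ : A → B} {p : ℕ} {w : Fin (p + 1) → B} {n : Fin (p + 1)}
    {M : Set A} (hB : IsMinTransBlock X Y Φ w n M) {y : ℤ → B} (hy : y ∈ Y) {s t r : ℤ}
    (hws : WAt w n y s) (hw : WAt w n y t) (hwr : WAt w n y r)
    (hs : s + p ≤ t) (hr : t + p ≤ r) {c : A} (hc : c ∈ M) :
    ∃ a ∈ M, ∃ b ∈ M, Conn X Φ y s t a c ∧ Conn X Φ y t r c b ∧
      ∀ c' ∈ M, Conn X Φ y s t a c' → Conn X Φ y t r c' b → c' = c := by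
  have hn0 := hB.1.2.1
  have hnp := hB.1.2.2.1
  obtain ⟨a, b, h1, h2, h3⟩ := conn_min hX1 hB hy (s := s - n.1) (r := r - n.1 + p) hw
    (by omega) (by omega) hc
  obtain ⟨a', ha', h4, h5⟩ := conn_route hX1 hB.1 hws le_rfl (by omega) h1
  obtain ⟨b', hb', h6, h7⟩ := conn_route hX1 hB.1 hwr (by omega) le_rfl h2
  exact ⟨a', ha', b', hb', h5, h6, fun c' hc' h8 h9 => h3 c' hc'
    (h4.trans hX1 (by omega) (by omega) h8) (h9.trans hX1 (by omega) (by omega) h7)⟩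

/-- In a sequence of relations indexed by an additive parameter some term is idempotent. -/
theorem exists_idem_rel {α : Type*} [Finite α] (E : ℕ → α → α → Prop)
    (hE : ∀ k l, 0 < k → 0 < l → ∀ a b, E (k + l) a b ↔ ∃ c, E k a c ∧ E l c b) :
    ∃ k, 0 < k ∧ E (k + k) = E k := by
  obtain ⟨i, j, hij, h⟩ := Finite.exists_ne_map_eq_of_infinite (fun k : ℕ => E (k + 1))
  wlog hlt : i < j generalizing i j
  · exact this j i hij.symm h.symm (by omega)
  try dsimp only at h
  obtain ⟨q, rfl⟩ : ∃ q, j = i + q := ⟨j - i, by omega⟩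
  have hq : 0 < q := by omega
  have h1 : ∀ k, i + 1 ≤ k → E (k + q) = E k := by
    intro k hk
    rcases Nat.eq_or_lt_of_le hk with h2 | h2
    · rw [← h2, h]; congr 1; omega
    · obtain ⟨l, rfl⟩ : ∃ l, k = (i + 1) + l := ⟨k - (i + 1), by omega⟩
      funext a b
      rw [show i + 1 + l + q = (i + q + 1) + l by omega]
      rw [eq_iff_iff, hE _ _ (by omega) (by omega), hE _ _ (by omega) (by omega), h]
  have h2 : ∀ l k, i + 1 ≤ k → E (k + l * q) = E k := by
    intro l
    induction l with
    | zero => intro k _; simp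
    | succ l ih =>
      intro k hk
      rw [Nat.succ_mul, ← add_assoc, h1 _ (by omega), ih k hk]
  refine ⟨(i + 1) * q, by positivity, h2 _ _ (Nat.le_mul_of_pos_right _ hq)⟩

theorem conn_iter [TopologicalSpace A] {X : Set (ℤ → A)} (hX1 : IsOneStep X)
    {Φ : A → B} {y : ℤ → B} {s : ℤ} {a : A} (N : ℤ) (hN : 0 ≤ N)
    (hy : ∀ m, y (m + N) = y m) (h : Conn X Φ y s (s + N) a a) (k : ℕ) :
    Conn X Φ y s (s + ((k + 1 : ℕ) : ℤ) * N) a a := by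
  induction k with
  | zero => simpa using h
  | succ k ih =>
    have h1 := ih.shift hX1 N hy
    have h2 : 0 ≤ ((k + 1 : ℕ) : ℤ) * N := by positivity
    have h3 := h.trans hX1 (by omega) (by omega) h1
    convert h3 using 1
    push_cast; ring

theorem periodic_mul {y : ℤ → B} {N : ℤ} (hy : ∀ m, y (m + N) = y m) (k : ℕ) :
    ∀ m, y (m + (k : ℤ) * N) = y m := by
  induction k with
  | zero => simp
  | succ k ih =>
    intro m
    rw [← ih m, ← hy (m + k * N)]; congr 1; push_cast; ring

theorem WAt.add {p : ℕ} {w : Fin (p + 1) → B} {n : Fin (p + 1)} {y : ℤ → B} {t N : ℤ}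
    (h : WAt w n y t) (hy : ∀ m, y (m + N) = y m) : WAt w n y (t + N) := by
  intro j
  rw [← h j, ← hy (t - (n.1 : ℤ) + (j.1 : ℤ))]; congr 1; ring

/-- The relation on `M` over one period is a partial order. -/
def PO (X : Set (ℤ → A)) (Φ : A → B) (M : Set A) (y : ℤ → B) (s N : ℤ) : Prop :=
  (∀ a ∈ M, Conn X Φ y s (s + N) a a) ∧
  (∀ a ∈ M, ∀ b ∈ M, Conn X Φ y s (s + N) a b → Conn X Φ y s (s + N) b a → a = b) ∧
  (∀ a ∈ M, ∀ b ∈ M, ∀ c ∈ M, Conn X Φ y s (s + N) a b → Conn X Φ y s (s + N) b c →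
    Conn X Φ y s (s + N) a c)

theorem exists_PO [Fintype A] [TopologicalSpace A] {X : Set (ℤ → A)} {Y : Set (ℤ → B)}
    (hX1 : IsOneStep X) {Φ : A → B} {p : ℕ} {w : Fin (p + 1) → B} {n : Fin (p + 1)}
    {M : Set A} (hB : IsMinTransBlock X Y Φ w n M) {y : ℤ → B} (hy : y ∈ Y) {s N : ℤ}
    (hw : WAt w n y s) (hN : (p : ℤ) ≤ N) (hper : ∀ m, y (m + N) = y m) :
    ∃ k : ℕ, PO X Φ M y s (((k + 1 : ℕ) : ℤ) * N) := by
  have hn0 := hB.1.2.1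
  have hnp := hB.1.2.2.1
  have hge : ∀ k : ℕ, 0 < k → N ≤ (k : ℤ) * N := by
    intro k hk
    have : (1 : ℤ) ≤ k := by exact_mod_cast hk
    nlinarith
  have hE : ∀ k l : ℕ, 0 < k → 0 < l → ∀ a b : M,
      Conn X Φ y s (s + ((k + l : ℕ) : ℤ) * N) a b ↔
      ∃ c : M, Conn X Φ y s (s + (k : ℤ) * N) a c ∧ Conn X Φ y s (s + (l : ℤ) * N) c b := by
    intro k l hk hl a b
    have e : s + ((k + l : ℕ) : ℤ) * N = s + (l : ℤ) * N + (k : ℤ) * N := by push_cast; ring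
    have h1 := hge k hk
    have h2 := hge l hl
    constructor
    · intro h
      rw [e] at h
      obtain ⟨c, hc, h3, h4⟩ := conn_route hX1 hB.1 (hw.add (periodic_mul hper k))
        (by omega) (by omega) h
      refine ⟨⟨c, hc⟩, h3, ?_⟩
      have h5 := h4.shift hX1 (-((k : ℤ) * N)) (fun m => by
        have := periodic_mul hper k (m + -((k : ℤ) * N))
        rw [neg_add_cancel_right] at this; exact this.symm)
      simpa using h5
    · rintro ⟨c, h3, h4⟩
      rw [e]
      exact h3.trans hX1 (by omega) (by omega) (h4.shift hX1 _ (periodic_mul hper k))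
  obtain ⟨k, hk, hidem⟩ := exists_idem_rel
    (fun (k : ℕ) (a b : M) => Conn X Φ y s (s + (k : ℤ) * N) a b) hE
  have hidem' : ∀ a b : M, Conn X Φ y s (s + (k : ℤ) * N) a b ↔
      ∃ c : M, Conn X Φ y s (s + (k : ℤ) * N) a c ∧ Conn X Φ y s (s + (k : ℤ) * N) c b := by
    intro a b
    rw [← hE k k hk hk]
    exact (iff_of_eq (congrFun (congrFun hidem a) b)).symm
  have hmin : ∀ c : M, ∃ a b : M, Conn X Φ y s (s + (k : ℤ) * N) a c ∧
      Conn X Φ y s (s + (k : ℤ) * N) c b ∧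
      ∀ c' : M, Conn X Φ y s (s + (k : ℤ) * N) a c' →
        Conn X Φ y s (s + (k : ℤ) * N) c' b → c' = c := by
    rintro ⟨c, hc⟩
    have hp := periodic_mul hper k
    have h1 := hge k hk
    obtain ⟨a, ha, b, hb, h3, h4, h5⟩ := conn_min' hX1 hB hy hw (hw.add hp)
      ((hw.add hp).add hp) (by omega) (by omega) hc
    refine ⟨⟨a, ha⟩, ⟨b, hb⟩, h3, ?_, ?_⟩
    · have h6 := h4.shift hX1 (-((k : ℤ) * N)) (fun m => by
        have := hp (m + -((k : ℤ) * N))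
        rw [neg_add_cancel_right] at this; exact this.symm)
      simpa using h6
    · rintro ⟨c', hc'⟩ h6 h7
      exact Subtype.ext (h5 c' hc' h6 (h7.shift hX1 _ hp))
  obtain ⟨k, rfl⟩ : ∃ l, k = l + 1 := ⟨k - 1, by omega⟩
  refine ⟨k, ?_, ?_, ?_⟩
  · intro c hc
    obtain ⟨a, b, h1, h2, h3⟩ := hmin ⟨c, hc⟩
    obtain ⟨e, h4, h5⟩ := (hidem' _ _).1 h1
    have := h3 e h4 ((hidem' _ _).2 ⟨_, h5, h2⟩)
    subst this
    exact h5
  · intro c hc c' hc' h h'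
    obtain ⟨a, b, h1, h2, h3⟩ := hmin ⟨c, hc⟩
    have := h3 ⟨c', hc'⟩ ((hidem' _ _).2 ⟨⟨c, hc⟩, h1, h⟩) ((hidem' _ _).2 ⟨⟨c, hc⟩, h', h2⟩)
    exact (congrArg Subtype.val this).symm
  · intro a ha b hb c hc h h'
    exact (hidem' ⟨a, ha⟩ ⟨c, hc⟩).2 ⟨⟨b, hb⟩, h, h'⟩

/-- Closing up a path to a periodic point. -/
theorem exists_loop [Fintype A] [TopologicalSpace A] {X : Set (ℤ → A)} {Y : Set (ℤ → B)}
    (hX1 : IsOneStep X) (hXirr : IrreducibleSubshift X) {Φ : A → B}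
    (hXY : ∀ x ∈ X, (fun m => Φ (x m)) ∈ Y)
    {p : ℕ} {w : Fin (p + 1) → B} {n : Fin (p + 1)}
    {M : Set A} (hB : IsMinTransBlock X Y Φ w n M) {y : ℤ → B} (hy : y ∈ Y) {s t : ℤ}
    (hws : WAt w n y s) (hwt : WAt w n y t) (hst : s + p ≤ t) {a b : A} (ha : a ∈ M)
    (hb : b ∈ M) (hab : Conn X Φ y s t a b) :
    ∃ y' ∈ Y, ∃ N : ℤ, t - s + p ≤ N ∧ (∀ m, y' (m + N) = y' m) ∧
      (∀ m, s - n.1 ≤ m → m ≤ t - n.1 + p → y' m = y m) ∧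
      Conn X Φ y' t (s + N) b a := by
  have hn0 := hB.1.2.1
  have hnp := hB.1.2.2.1
  obtain ⟨_, _, ⟨x1, hx1, _, e1, o1⟩, _⟩ := conn_min hX1 hB hy hws le_rfl le_rfl ha
  obtain ⟨_, _, _, ⟨x3, hx3, e3, _, o3⟩, _⟩ := conn_min hX1 hB hy hwt le_rfl le_rfl hb
  obtain ⟨x2, hx2, e2, e2', o2⟩ := hab
  obtain ⟨x, hx, hxs, hxt, ho⟩ : ∃ x ∈ X, x s = a ∧ x t = b ∧
      ∀ m, s - n.1 ≤ m → m ≤ t - n.1 + p → Φ (x m) = y m := by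
    have h23 := splice_mem hX1 hx2 hx3 t (by rw [e2', e3])
    have h123 := splice_mem hX1 hx1 h23 s (by
      (try dsimp only); rw [if_pos (by omega), e1, e2])
    refine ⟨_, h123, ?_, ?_, ?_⟩
    · simp [e1]
    · (try dsimp only); rw [if_neg (by omega), if_pos le_rfl, e2']
    · intro m h1 h2
      (try dsimp only)
      split_ifs with h3 h4
      · exact o1 m h1 h3
      · exact o2 m (by omega) h4
      · exact o3 m (by omega) h2
  obtain ⟨L, hL⟩ : ∃ L : ℕ, (L : ℤ) = t - s + p + 1 := ⟨(t - s + p + 1).toNat, by omega⟩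
  have hocc : OccursIn (fun j : Fin L => x (s - n.1 + (j.1 : ℤ))) X :=
    ⟨x, hx, _, fun j => rfl⟩
  obtain ⟨z, hz, i, k, hik, hi, hk⟩ := hXirr L L _ _ hocc hocc
  have hper : z (i + (k - i)) = z i := by
    have h1 := hi ⟨0, by omega⟩
    have h2 := hk ⟨0, by omega⟩
    simp only [Nat.cast_zero, add_zero] at h1 h2
    rw [add_sub_cancel, h1, h2]
  have hN : 0 < k - i := by omega
  have hmem := periodic_mem hX1 hz i (s - n.1) (k - i) hN hper
  set ξ : ℤ → A := fun m => z (i + (m - (s - n.1)) % (k - i)) with hξ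
  have hξp : ∀ m, ξ (m + (k - i)) = ξ m := by
    intro m
    simp only [hξ]
    rw [show m + (k - i) - (s - (n.1 : ℤ)) = m - (s - n.1) + (k - i) by ring,
      Int.add_emod_right]
  have hξx : ∀ m, s - n.1 ≤ m → m ≤ t - n.1 + p → ξ m = x m := by
    intro m h1 h2
    simp only [hξ]
    rw [Int.emod_eq_of_lt (by omega) (by omega)]
    have h3 := hi ⟨(m - (s - n.1)).toNat, by omega⟩
    have e : (((m - (s - n.1)).toNat : ℕ) : ℤ) = m - (s - n.1) := by omega
    simp only [e, add_sub_cancel] at h3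
    exact h3
  refine ⟨_, hXY ξ hmem, k - i, by omega, ?_, ?_, ?_⟩
  · intro m; simp only [hξp]
  · intro m h1 h2; simp only [hξx m h1 h2, ho m h1 h2]
  · refine ⟨ξ, hmem, ?_, ?_, fun _ _ _ => rfl⟩
    · rw [hξx _ (by omega) (by omega), hxt]
    · rw [hξp, hξx _ (by omega) (by omega), hxs]

/-- The combinatorial core. -/
theorem core [Fintype A] [TopologicalSpace A] {X : Set (ℤ → A)} {Y : Set (ℤ → B)}
    (hX1 : IsOneStep X) (hXirr : IrreducibleSubshift X) {Φ : A → B}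
    (hXY : ∀ x ∈ X, (fun m => Φ (x m)) ∈ Y)
    {p : ℕ} {w : Fin (p + 1) → B} {n : Fin (p + 1)}
    {M : Set A} (hB : IsMinTransBlock X Y Φ w n M) {y : ℤ → B} (hy : y ∈ Y) {s t : ℤ}
    (hws : WAt w n y s) (hwt : WAt w n y t) (hst : s + p ≤ t) {a b : A} (ha : a ∈ M)
    (hb : b ∈ M) (hab : Conn X Φ y s t a b) :
    ∃ y' ∈ Y, ∃ N : ℤ, t - s + p ≤ N ∧ (∀ m, y' (m + N) = y' m) ∧
      (∀ m, s - n.1 ≤ m → m ≤ t - n.1 + p → y' m = y m) ∧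
      Conn X Φ y' t (s + N) b a ∧ WAt w n y' s ∧ PO X Φ M y' s N ∧
      ∃ f : M → M, Function.Injective f ∧ ∀ c : M, Conn X Φ y' s t c (f c) ∧
        Conn X Φ y' t (s + N) (f c) c := by
  have hn0 := hB.1.2.1
  have hnp := hB.1.2.2.1
  obtain ⟨y', hy', N, hN, hper, hagr, hba⟩ :=
    exists_loop hX1 hXirr hXY hB hy hws hwt hst ha hb hab
  have hws' : WAt w n y' s := fun j => by
    have := j.2
    rw [hagr _ (by omega) (by omega)]; exact hws j
  have hwt' : WAt w n y' t := fun j => by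
    have := j.2
    rw [hagr _ (by omega) (by omega)]; exact hwt j
  obtain ⟨k, hPO⟩ := exists_PO hX1 hB hy' hws' (by omega) hper
  have hge : N ≤ ((k + 1 : ℕ) : ℤ) * N := by
    push_cast
    have : (0 : ℤ) ≤ (k : ℤ) * N := by
      have : (0 : ℤ) ≤ N := by omega
      positivity
    nlinarith
  have hba' : Conn X Φ y' t (s + ((k + 1 : ℕ) : ℤ) * N) b a := by
    have hab' : Conn X Φ y' s t a b := hab.congr (fun m h1 h2 => hagr m (by omega) (by omega))
    cases k with
    | zero => simpa using hba
    | succ k =>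
      have h1 := conn_iter hX1 N (by omega) hper
        (hab'.trans hX1 (by omega) (by omega) hba) k
      have h2 := h1.shift hX1 N hper
      have h3 : 0 ≤ ((k + 1 : ℕ) : ℤ) * N := by
        have : (0 : ℤ) ≤ N := by omega
        positivity
      have h4 := hba.trans hX1 (by omega) (by omega) h2
      convert h4 using 1
      push_cast; ring
  have hf : ∀ c : M, ∃ d : M, Conn X Φ y' s t c d ∧
      Conn X Φ y' t (s + ((k + 1 : ℕ) : ℤ) * N) d c := by
    rintro ⟨c, hc⟩
    obtain ⟨d, hd, h1, h2⟩ := conn_route hX1 hB.1 hwt' (by omega) (by omega) (hPO.1 c hc)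
    exact ⟨⟨d, hd⟩, h1, h2⟩
  choose f hf using hf
  refine ⟨y', hy', _, by omega, periodic_mul hper (k + 1), hagr, hba', hws', hPO, f, ?_, hf⟩
  intro c c' hcc
  have h1 := (hf c).1.trans hX1 (by omega) (by omega) (hcc ▸ (hf c').2)
  have h2 := (hf c').1.trans hX1 (by omega) (by omega) (hcc ▸ (hf c).2)
  exact Subtype.ext (hPO.2.1 _ c.2 _ c'.2 h1 h2)

theorem PO_eq [Fintype A] [TopologicalSpace A] {X : Set (ℤ → A)} {Y : Set (ℤ → B)}
    (hX1 : IsOneStep X) (hXirr : IrreducibleSubshift X) {Φ : A → B}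
    (hXY : ∀ x ∈ X, (fun m => Φ (x m)) ∈ Y)
    {p : ℕ} {w : Fin (p + 1) → B} {n : Fin (p + 1)}
    {M : Set A} (hB : IsMinTransBlock X Y Φ w n M) {y : ℤ → B} (hy : y ∈ Y) {s N : ℤ}
    (hw : WAt w n y s) (hN : (p : ℤ) ≤ N) (hper : ∀ m, y (m + N) = y m)
    (hPO : PO X Φ M y s N) {a b : A} (ha : a ∈ M) (hb : b ∈ M)
    (hab : Conn X Φ y s (s + N) a b) : a = b := by
  have hn0 := hB.1.2.1
  have hnp := hB.1.2.2.1
  obtain ⟨y', hy', N', hN', hper', hagr, hba, hw', hPO', f, hfi, hf⟩ :=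
    core hX1 hXirr hXY hB hy hw (hw.add hper) (by omega) ha hb hab
  have hto : ∀ c d, Conn X Φ y s (s + N) c d → Conn X Φ y' s (s + N) c d :=
    fun c d h => h.congr (fun m h1 h2 => hagr m (by omega) (by omega))
  have hfrom : ∀ c d, Conn X Φ y' s (s + N) c d → Conn X Φ y s (s + N) c d :=
    fun c d h => h.congr (fun m h1 h2 => (hagr m (by omega) (by omega)).symm)
  -- `f a = b`
  obtain ⟨a', ha'⟩ := (Finite.injective_iff_surjective.1 hfi) ⟨b, hb⟩
  have h1 := hf a'
  rw [ha'] at h1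
  have h2 : a = a' := hPO'.2.1 a ha a' a'.2
    ((hto _ _ hab).trans hX1 (by omega) (by omega) h1.2)
    (h1.1.trans hX1 (by omega) (by omega) hba)
  -- iterate
  have h3 : ∀ k : ℕ, Conn X Φ y s (s + N) (b : A) (f^[k] ⟨b, hb⟩ : M) := by
    intro k
    induction k with
    | zero => exact hPO.1 b hb
    | succ k ih =>
      rw [Function.iterate_succ_apply']
      exact hPO.2.2 _ hb _ (Subtype.prop _) _ (Subtype.prop _) ih (hfrom _ _ (hf _).1)
  obtain ⟨k, hk, hk'⟩ := hfi.mem_periodicPts a'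
  obtain ⟨k, rfl⟩ : ∃ l, k = l + 1 := ⟨k - 1, by omega⟩
  have h4 := h3 k
  rw [← ha', ← Function.iterate_succ_apply, hk', ← h2] at h4
  exact hPO.2.1 a ha b hb hab h4

/-- Connection between occurrences of `w` is injective on `M`. -/
theorem conn_inj [Fintype A] [TopologicalSpace A] {X : Set (ℤ → A)} {Y : Set (ℤ → B)}
    (hX1 : IsOneStep X) (hXirr : IrreducibleSubshift X) {Φ : A → B}
    (hXY : ∀ x ∈ X, (fun m => Φ (x m)) ∈ Y)
    {p : ℕ} {w : Fin (p + 1) → B} {n : Fin (p + 1)}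
    {M : Set A} (hB : IsMinTransBlock X Y Φ w n M) {y : ℤ → B} (hy : y ∈ Y) {s t : ℤ}
    (hws : WAt w n y s) (hwt : WAt w n y t) (hst : s + p ≤ t) {a a' b : A} (ha : a ∈ M)
    (ha' : a' ∈ M) (hb : b ∈ M) (hab : Conn X Φ y s t a b) (hab' : Conn X Φ y s t a' b) :
    a = a' := by
  have hn0 := hB.1.2.1
  have hnp := hB.1.2.2.1
  obtain ⟨y', hy', N', hN', hper', hagr, hba, hw', hPO', f, hfi, hf⟩ :=
    core hX1 hXirr hXY hB hy hws hwt hst ha hb hab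
  have hto : ∀ c d, Conn X Φ y s t c d → Conn X Φ y' s t c d :=
    fun c d h => h.congr (fun m h1 h2 => hagr m (by omega) (by omega))
  obtain ⟨c, hc⟩ := (Finite.injective_iff_surjective.1 hfi) ⟨b, hb⟩
  have h1 := hf c
  rw [hc] at h1
  have h2 := PO_eq hX1 hXirr hXY hB hy' hw' (by omega) hper' hPO' ha c.2
    ((hto _ _ hab).trans hX1 (by omega) (by omega) h1.2)
  have h3 := PO_eq hX1 hXirr hXY hB hy' hw' (by omega) hper' hPO' ha' c.2
    ((hto _ _ hab').trans hX1 (by omega) (by omega) h1.2)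
  rw [h2, h3]

/-- A transition class only depends on right tails. -/
theorem transClass_tail [TopologicalSpace A] {X : Set (ℤ → A)} (hX1 : IsOneStep X)
    {π : (ℤ → A) → ℤ → B} {Φ : A → B} (hΦ : OneBlockRule π Φ) {x0 x x1 : ℤ → A}
    (hx : x ∈ transClass X π x0) (hx1 : x1 ∈ X) (hπ : π x1 = π x0) (K : ℤ)
    (hK : ∀ m, K ≤ m → x1 m = x m) : x1 ∈ transClass X π x0 := by
  obtain ⟨hxX, hxπ, h1, h2⟩ := hx
  refine ⟨hx1, hπ, ?_, ?_⟩
  · intro n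
    obtain ⟨z, hz, hzπ, hl, k, hk, hr⟩ := h1 n
    refine ⟨z, hz, hzπ, hl, max k K, by omega, fun m hm => ?_⟩
    rw [hr m (by omega), hK m (by omega)]
  · intro n
    obtain ⟨z, hz, hzπ, hl, k, hk, hr⟩ := h2 (max n K)
    refine ⟨_, splice_mem hX1 hx1 hz (max n K) ?_, ?_, ?_, ?_⟩
    · rw [hl _ le_rfl, hK _ (by omega)]
    · funext m
      have e1 := hΦ x1 m
      have e2 := hΦ z m
      rw [hΦ]
      split_ifs
      · exact e1.symm
      · rw [← e2, hzπ, hxπ, hπ]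
    · intro m hm
      (try dsimp only)
      rw [if_pos (by omega)]
    · refine ⟨k + 1, by omega, fun m hm => ?_⟩
      (try dsimp only)
      rw [if_neg (by omega), hr m (by omega)]

theorem class_routable_through_unique_symbol [Fintype A] [TopologicalSpace A] [DiscreteTopology A]
    [Fintype B] [TopologicalSpace B] [DiscreteTopology B]
    (X : Set (ℤ → A)) (Y : Set (ℤ → B)) (π : (ℤ → A) → ℤ → B) (Φ : A → B)
    (hT : FactorTriple X Y π) (hXirr : IrreducibleSubshift X)
    (hX1 : IsOneStep X) (hΦ : OneBlockRule π Φ)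
    (p : ℕ) (w : Fin (p + 1) → B) (n : Fin (p + 1)) (M : Set A)
    (hmin : IsMinTransBlock X Y Φ w n M)
    (y : ℤ → B) (hy : RightTransitive Y y)
    (i : ℤ) (hocc : ∀ j : Fin (p + 1), y (i + (j.1 : ℤ)) = w j) :
    ∀ C ∈ transClassesOver X π y,
      (∃! b, b ∈ M ∧ ∀ x ∈ C, Routable X Φ w (fun j => x (i + (j.1 : ℤ))) n b) ∧
      Nat.card ({a | ∃ x ∈ C, x (i + (n.1 : ℤ)) = a} ∩ M : Set A) = 1 := by
  have hXY : ∀ x ∈ X, (fun m => Φ (x m)) ∈ Y := by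
    intro x hx
    have h1 := hT.2.2.2.1 x hx
    have h2 : π x = fun m => Φ (x m) := funext (hΦ x)
    rwa [h2] at h1
  have hn0 := hmin.1.2.1
  have hnp := hmin.1.2.2.1
  have hws : WAt w n y (i + n.1) := fun j => by
    rw [add_sub_cancel_right]; exact hocc j
  rintro C ⟨x0, hx0, hx0y, rfl⟩
  have hover : ∀ x ∈ transClass X π x0, ∀ m, Φ (x m) = y m := by
    intro x hx m
    rw [← hΦ, hx.2.1, hx0y]
  -- a far occurrence of `w`
  have hfar : ∀ K : ℤ, ∃ t, K ≤ t ∧ WAt w n y t := by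
    intro K
    have hz : shiftMap (i + n.1 - max K 0) y ∈ Y := hT.2.1.2 _ _ hy.1
    obtain ⟨k, hk, h⟩ := hy.2 _ hz (max K 0 + p).toNat
    refine ⟨max K 0 + k, by omega, fun j => ?_⟩
    have hj := j.2
    have h1 := h (max K 0 - n.1 + j.1) (by rw [abs_le]; omega)
    rw [show max K 0 + k - (n.1 : ℤ) + j.1 = max K 0 - n.1 + j.1 + k by ring, h1, ← hocc j]
    simp only [shiftMap]
    congr 1; ring
  have huniq : ∀ x ∈ transClass X π x0, ∀ x' ∈ transClass X π x0,
      x (i + n.1) ∈ M → x' (i + n.1) ∈ M → x (i + n.1) = x' (i + n.1) := by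
    intro x hx x' hx' hM hM'
    obtain ⟨z, hz, hzπ, hl, k, hk, hr⟩ := hx.2.2.2 (i + n.1)
    obtain ⟨z', hz', hzπ', hl', k', hk', hr'⟩ := hx'.2.2.2 (i + n.1)
    obtain ⟨t, ht, hwt⟩ := hfar (max k k' + p)
    have hzo : ∀ m, Φ (z m) = y m := fun m => by rw [← hΦ, hzπ, hx.2.1, hx0y]
    have hzo' : ∀ m, Φ (z' m) = y m := fun m => by rw [← hΦ, hzπ', hx'.2.1, hx0y]
    have hK : Conn X Φ y (max k k') (t - n.1 + p) (x0 (max k k')) (x0 (t - n.1 + p)) :=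
      ⟨x0, hx0, rfl, rfl, fun m _ _ => by rw [← hΦ, hx0y]⟩
    obtain ⟨c, hc, h1, _⟩ := conn_route hX1 hmin.1 hwt (by omega) le_rfl hK
    have g1 : Conn X Φ y (i + n.1) (max k k') (x (i + n.1)) (x0 (max k k')) :=
      ⟨z, hz, hl _ le_rfl, hr _ (by omega), fun m _ _ => hzo m⟩
    have g2 : Conn X Φ y (i + n.1) (max k k') (x' (i + n.1)) (x0 (max k k')) :=
      ⟨z', hz', hl' _ le_rfl, hr' _ (by omega), fun m _ _ => hzo' m⟩
    exact conn_inj hX1 hXirr hXY hmin hy.1 hws hwt (by omega) hM hM' hc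
      (g1.trans hX1 (by omega) (by omega) h1) (g2.trans hX1 (by omega) (by omega) h1)
  -- routing inside the class
  have hroute : ∀ x ∈ transClass X π x0, ∀ b,
      Routable X Φ w (fun j => x (i + (j.1 : ℤ))) n b →
      ∃ x1 ∈ transClass X π x0, x1 (i + n.1) = b := by
    intro x hx b hR
    rw [routable_iff_conn hX1 hocc] at hR
    simp only [Fin.val_zero, Fin.val_last, Nat.cast_zero, add_zero] at hR
    obtain ⟨⟨u, hu, us, ut, uo⟩, ⟨v, hv, vs, vt, vo⟩⟩ := hR
    have m1 := splice_mem hX1 hv hx.1 (i + p) vt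
    have m2 := splice_mem hX1 hu m1 (i + n.1) (by
      (try dsimp only); rw [if_pos (by omega), ut, vs])
    have m3 := splice_mem hX1 hx.1 m2 i (by
      (try dsimp only); rw [if_pos (by omega), us])
    refine ⟨_, transClass_tail hX1 hΦ hx m3 ?_ (i + p + 1) ?_, ?_⟩
    · rw [hx0y]
      funext m
      rw [hΦ]
      split_ifs with h1 h2 h3
      · exact hover x hx m
      · exact uo m (by omega) h2
      · exact vo m (by omega) h3
      · exact hover x hx m
    · intro m hm
      (try dsimp only)
      rw [if_neg (by omega), if_neg (by omega), if_neg (by omega)]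
    · (try dsimp only)
      rw [if_neg (by omega), if_pos le_rfl, ut]
  have hex : ∀ x ∈ transClass X π x0, ∃ b ∈ M,
      Routable X Φ w (fun j => x (i + (j.1 : ℤ))) n b := by
    intro x hx
    exact hmin.1.2.2.2.2 _ ⟨⟨x, hx.1, i, fun j => rfl⟩, fun j => by
      rw [hover x hx]; exact hocc j⟩
  have hself : x0 ∈ transClass X π x0 := by
    have h : TransitionTo X π x0 x0 := fun n =>
      ⟨x0, hx0, rfl, fun _ _ => rfl, n, le_rfl, fun _ _ => rfl⟩
    exact ⟨hx0, rfl, h, h⟩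
  obtain ⟨b, hbM, hbR⟩ := hex x0 hself
  obtain ⟨x1, hx1, hx1b⟩ := hroute x0 hself b hbR
  have hb : ∀ x ∈ transClass X π x0, x (i + n.1) ∈ M → x (i + n.1) = b := by
    intro x hx hM
    rw [← hx1b]
    exact huniq x hx x1 hx1 hM (hx1b ▸ hbM)
  have hb' : ∀ x ∈ transClass X π x0, ∀ b' ∈ M,
      Routable X Φ w (fun j => x (i + (j.1 : ℤ))) n b' → b' = b := by
    intro x hx b' hb'M hR
    obtain ⟨x2, hx2, h2⟩ := hroute x hx b' hR
    rw [← h2]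
    exact hb x2 hx2 (h2 ▸ hb'M)
  refine ⟨⟨b, ⟨hbM, ?_⟩, ?_⟩, ?_⟩
  · intro x hx
    obtain ⟨b', hb'M, hR⟩ := hex x hx
    rwa [hb' x hx b' hb'M hR] at hR
  · rintro b' ⟨hb'M, hR⟩
    exact hb' x0 hself b' hb'M (hR x0 hself)
  · have : ({a | ∃ x ∈ transClass X π x0, x (i + (n.1 : ℤ)) = a} ∩ M : Set A) = {b} := by
      ext a
      constructor
      · rintro ⟨⟨x, hx, rfl⟩, hM⟩
        exact hb x hx hM
      · rintro rfl
        exact ⟨⟨x1, hx1, hx1b⟩, hbM⟩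
    rw [this]
    simp
end
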